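/- arXiv:1710.10605 — 2 statements merged into one kernel-verified Lean document; each statement's English description precedes it below -/
import Mathlib

section
/- (Proposition 1) Let D ≥ 2 and let T^{ij} be a smooth symmetric tensor field on ℝ^D satisfying ∂_j T^{ij}=0 for all i. Then there exists a smooth tensor field R^{ikjp} on ℝ^D having Riemann symmetries such that T^{ij} = ∂_k∂_p R^{ikjp} (sum over k,p). -/
/-- Partial derivative in the k-th Cartesian coordinate direction on ℝ^D. -/
noncomputable def pd {D : ℕ} (k : Fin D) (f : (Fin D → ℝ) → ℝ) : (Fin D → ℝ) → ℝ :=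
  fun x => fderiv ℝ f x (Pi.single k 1)

section RadialIntegral

variable {V : Type} [NormedAddCommGroup V] [NormedSpace ℝ V]
  {F : Type} [NormedAddCommGroup F] [NormedSpace ℝ F]

/-- The weighted radial average `x ↦ ∫₀¹ tᵐ f (t x) dt`. -/
noncomputable def radialIntegral (m : ℕ) (f : V → F) : V → F :=
  fun x => ∫ t in (0 : ℝ)..1, t ^ m • f (t • x)

theorem continuous_radialIntegral (m : ℕ) {f : V → F} (hf : Continuous f) :
    Continuous (radialIntegral m f) := by
  unfold radialIntegral
  apply intervalIntegral.continuous_parametric_intervalIntegral_of_continuous'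
  fun_prop

theorem hasFDerivAt_radialIntegral [ProperSpace V] (m : ℕ) {f : V → F} (hf : ContDiff ℝ 1 f)
    (x : V) :
    HasFDerivAt (radialIntegral m f) (radialIntegral (m + 1) (fderiv ℝ f) x) x := by
  have hcf : Continuous f := hf.continuous
  have hcf' : Continuous (fderiv ℝ f) := hf.continuous_fderiv one_ne_zero
  have hc : Continuous fun q : V × ℝ => q.2 ^ (m + 1) • fderiv ℝ f (q.2 • q.1) := by fun_prop
  obtain ⟨C, hC⟩ := ((isCompact_closedBall x 1).prod
    (isCompact_Icc (a := (0 : ℝ)) (b := 1))).exists_bound_of_continuousOn hc.continuousOn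
  refine intervalIntegral.hasFDerivAt_integral_of_dominated_of_fderiv_le
    (F := fun y t => t ^ m • f (t • y)) (F' := fun y t => t ^ (m + 1) • fderiv ℝ f (t • y))
    (bound := fun _ => C) (Metric.closedBall_mem_nhds x one_pos) ?_ ?_ ?_ ?_ ?_ ?_
  · refine Filter.Eventually.of_forall fun y => Continuous.aestronglyMeasurable ?_
    fun_prop
  · apply Continuous.intervalIntegrable
    fun_prop
  · have : SecondCountableTopologyEither ℝ (V →L[ℝ] F) := secondCountableTopologyEither_of_left ..
    apply Continuous.aestronglyMeasurable
    fun_prop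
  · refine Filter.Eventually.of_forall fun t ht y hy => hC (y, t) ⟨hy, ?_⟩
    rw [Set.uIoc_of_le zero_le_one] at ht
    exact ⟨ht.1.le, ht.2⟩
  · exact intervalIntegrable_const
  · refine Filter.Eventually.of_forall fun t _ y _ => ?_
    have hd : HasFDerivAt f (fderiv ℝ f (t • y)) (t • y) :=
      (hf.differentiable one_ne_zero _).hasFDerivAt
    have h := (hd.comp y ((hasFDerivAt_id y).const_smul t)).const_smul (t ^ m)
    refine h.congr_fderiv ?_
    ext v
    simp [pow_succ, mul_smul]

theorem fderiv_radialIntegral [ProperSpace V] (m : ℕ) {f : V → F} (hf : ContDiff ℝ 1 f) :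
    fderiv ℝ (radialIntegral m f) = radialIntegral (m + 1) (fderiv ℝ f) :=
  funext fun x => (hasFDerivAt_radialIntegral m hf x).fderiv

theorem contDiff_nat_radialIntegral [ProperSpace V] (n : ℕ) :
    ∀ {F : Type} [NormedAddCommGroup F] [NormedSpace ℝ F] (m : ℕ) {f : V → F},
      ContDiff ℝ n f → ContDiff ℝ n (radialIntegral m f) := by
  induction n with
  | zero =>
    intro F _ _ m f hf
    exact contDiff_zero.2 (continuous_radialIntegral m hf.continuous)
  | succ n ih =>
    intro F _ _ m f hf
    have h1 : ContDiff ℝ 1 f := hf.of_le (by exact_mod_cast Nat.le_add_left 1 n)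
    rw [Nat.cast_succ] at hf ⊢
    rw [contDiff_succ_iff_fderiv] at hf ⊢
    refine ⟨fun x => (hasFDerivAt_radialIntegral m h1 x).differentiableAt, by simp, ?_⟩
    rw [fderiv_radialIntegral m h1]
    exact ih (m + 1) hf.2.2

theorem ContDiff.radialIntegral [ProperSpace V] (m : ℕ) {f : V → F}
    (hf : ContDiff ℝ (⊤ : ℕ∞) f) : ContDiff ℝ (⊤ : ℕ∞) (radialIntegral m f) :=
  contDiff_infty.2 fun n => contDiff_nat_radialIntegral n m (contDiff_infty.1 hf n)

/-- `radialIntegral m` inverts `m + 1` plus the Euler operator. -/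
theorem fderiv_radialIntegral_apply_self [ProperSpace V] [CompleteSpace F] (m : ℕ) {f : V → F}
    (hf : ContDiff ℝ 1 f) (x : V) :
    fderiv ℝ (radialIntegral m f) x x + ((m : ℝ) + 1) • radialIntegral m f x = f x := by
  have hcf : Continuous f := hf.continuous
  have hcf' : Continuous (fderiv ℝ f) := hf.continuous_fderiv one_ne_zero
  have hderiv : ∀ t : ℝ, HasDerivAt (fun t : ℝ => t ^ (m + 1) • f (t • x))
      (t ^ (m + 1) • fderiv ℝ f (t • x) x + ((m : ℝ) + 1) • t ^ m • f (t • x)) t := by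
    intro t
    have hd : HasFDerivAt f (fderiv ℝ f (t • x)) (t • x) :=
      (hf.differentiable one_ne_zero _).hasFDerivAt
    have h := (hasDerivAt_pow (m + 1) t).smul
      (hd.comp_hasDerivAt t ((hasDerivAt_id t).smul_const x))
    refine h.congr_deriv ?_
    simp [mul_smul]
  have hi1 : Continuous fun t : ℝ => t ^ (m + 1) • fderiv ℝ f (t • x) x := by fun_prop
  have hi2 : Continuous fun t : ℝ => ((m : ℝ) + 1) • t ^ m • f (t • x) := by fun_prop
  have hi3 : Continuous fun t : ℝ => t ^ (m + 1) • fderiv ℝ f (t • x) := by fun_prop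
  have h := intervalIntegral.integral_eq_sub_of_hasDerivAt (a := 0) (b := 1)
    (fun t _ => hderiv t) ((hi1.add hi2).intervalIntegrable 0 1)
  rw [intervalIntegral.integral_add (hi1.intervalIntegrable 0 1) (hi2.intervalIntegrable 0 1),
    intervalIntegral.integral_smul] at h
  rw [fderiv_radialIntegral m hf]
  unfold radialIntegral
  rw [ContinuousLinearMap.intervalIntegral_apply (hi3.intervalIntegrable 0 1)]
  simpa using h

end RadialIntegral

section PartialDerivative

variable {D : ℕ}

theorem pd_sub {f g : (Fin D → ℝ) → ℝ} {x : Fin D → ℝ} (k : Fin D)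
    (hf : DifferentiableAt ℝ f x) (hg : DifferentiableAt ℝ g x) :
    pd k (fun y => f y - g y) x = pd k f x - pd k g x := by
  simp [pd, fderiv_fun_sub hf hg]

theorem pd_add {f g : (Fin D → ℝ) → ℝ} {x : Fin D → ℝ} (k : Fin D)
    (hf : DifferentiableAt ℝ f x) (hg : DifferentiableAt ℝ g x) :
    pd k (fun y => f y + g y) x = pd k f x + pd k g x := by
  simp [pd, fderiv_fun_add hf hg]

theorem pd_sum {ι : Type*} {s : Finset ι} {f : ι → (Fin D → ℝ) → ℝ} {x : Fin D → ℝ} (k : Fin D)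
    (hf : ∀ i ∈ s, DifferentiableAt ℝ (f i) x) :
    pd k (fun y => ∑ i ∈ s, f i y) x = ∑ i ∈ s, pd k (f i) x := by
  simp [pd, fderiv_fun_sum hf]

theorem pd_coord_mul {f : (Fin D → ℝ) → ℝ} {x : Fin D → ℝ} (k a : Fin D)
    (hf : DifferentiableAt ℝ f x) :
    pd k (fun y => y a * f y) x = (if a = k then f x else 0) + x a * pd k f x := by
  have h := ((ContinuousLinearMap.proj (R := ℝ) (φ := fun _ : Fin D => ℝ) a).hasFDerivAt
    (x := x)).mul hf.hasFDerivAt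
  have h' : HasFDerivAt (fun y : Fin D → ℝ => y a * f y) _ x := h
  simp [pd, h'.fderiv, Pi.single_apply, add_comm]

theorem contDiff_pd {f : (Fin D → ℝ) → ℝ} (k : Fin D) (hf : ContDiff ℝ (⊤ : ℕ∞) f) :
    ContDiff ℝ (⊤ : ℕ∞) (pd k f) :=
  (contDiff_infty_iff_fderiv.1 hf).2.clm_apply contDiff_const

theorem fderiv_apply_self_eq_sum_pd (f : (Fin D → ℝ) → ℝ) (x : Fin D → ℝ) :
    fderiv ℝ f x x = ∑ k, x k * pd k f x := by
  refine (LinearMap.pi_apply_eq_sum_univ (fderiv ℝ f x : (Fin D → ℝ) →ₗ[ℝ] ℝ) x).trans ?_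
  refine Finset.sum_congr rfl fun k _ => ?_
  have hk : (fun j => if k = j then (1 : ℝ) else 0) = Pi.single k 1 := by
    ext j
    simp [Pi.single_apply, eq_comm]
  rw [hk]
  rfl

theorem pd_radialIntegral (k : Fin D) (m : ℕ) {f : (Fin D → ℝ) → ℝ} (hf : ContDiff ℝ 1 f) :
    pd k (radialIntegral m f) = radialIntegral (m + 1) (pd k f) := by
  have hcf' : Continuous (fderiv ℝ f) := hf.continuous_fderiv one_ne_zero
  funext x
  have hi : Continuous fun t : ℝ => t ^ (m + 1) • fderiv ℝ f (t • x) := by fun_prop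
  unfold pd
  rw [fderiv_radialIntegral m hf]
  unfold radialIntegral
  rw [ContinuousLinearMap.intervalIntegral_apply (hi.intervalIntegrable 0 1)]
  rfl

theorem sum_mul_pd_radialIntegral (m : ℕ) {f : (Fin D → ℝ) → ℝ} (hf : ContDiff ℝ 1 f)
    (x : Fin D → ℝ) :
    ∑ k, x k * pd k (radialIntegral m f) x = f x - ((m : ℝ) + 1) * radialIntegral m f x := by
  rw [← fderiv_apply_self_eq_sum_pd, eq_sub_iff_add_eq]
  exact fderiv_radialIntegral_apply_self m hf x

theorem sum_pd_radialIntegral_eq_zero (m : ℕ) {f : Fin D → (Fin D → ℝ) → ℝ}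
    (hf : ∀ j, ContDiff ℝ (⊤ : ℕ∞) (f j)) (hdiv : ∀ x, ∑ j, pd j (f j) x = 0) (x : Fin D → ℝ) :
    ∑ j, pd j (radialIntegral m (f j)) x = 0 := by
  have hc : ∀ j, Continuous (pd j (f j)) := fun j => (contDiff_pd j (hf j)).continuous
  simp_rw [fun j => pd_radialIntegral j m ((hf j).of_le (by exact_mod_cast le_top))]
  unfold radialIntegral
  rw [← intervalIntegral.integral_finsetSum]
  · simp_rw [← Finset.smul_sum, hdiv]
    simp
  · intro j _
    have := hc j
    apply Continuous.intervalIntegrable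
    fun_prop

/-- The Kulkarni–Nomizu product of `x ⊗ x` with a tensor field `S`. -/
def positionKulkarniNomizu (S : Fin D → Fin D → (Fin D → ℝ) → ℝ) (i k j p : Fin D) :
    (Fin D → ℝ) → ℝ :=
  fun x => x k * (x p * S i j x) - x i * (x p * S k j x)
    - x k * (x j * S i p x) + x i * (x j * S k p x)

theorem contDiff_positionKulkarniNomizu {S : Fin D → Fin D → (Fin D → ℝ) → ℝ}
    (hS : ∀ i j, ContDiff ℝ (⊤ : ℕ∞) (S i j)) (i k j p : Fin D) :
    ContDiff ℝ (⊤ : ℕ∞) (positionKulkarniNomizu S i k j p) := by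
  have h1 := hS i j
  have h2 := hS k j
  have h3 := hS i p
  have h4 := hS k p
  unfold positionKulkarniNomizu
  fun_prop

theorem sum_pd_positionKulkarniNomizu {S : Fin D → Fin D → (Fin D → ℝ) → ℝ}
    (hS : ∀ i j, Differentiable ℝ (S i j)) (hsym : ∀ i j x, S i j x = S j i x)
    (hdiv : ∀ i x, ∑ j, pd j (S i j) x = 0) (i k j : Fin D) (x : Fin D → ℝ) :
    ∑ p, pd p (positionKulkarniNomizu S i k j p) x =
      x k * (∑ p, x p * pd p (S i j) x + D * S i j x)
        - x i * (∑ p, x p * pd p (S k j) x + D * S k j x) := by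
  have hd : ∀ a b, DifferentiableAt ℝ (S a b) x := fun a b => hS a b x
  have h1 : ∀ a c d, DifferentiableAt ℝ (fun y : Fin D → ℝ => y a * S c d y) x := by
    intro a c d; have := hd c d; fun_prop
  have h2 : ∀ a b c d, DifferentiableAt ℝ (fun y : Fin D → ℝ => y a * (y b * S c d y)) x := by
    intro a b c d; have := h1 b c d; fun_prop
  have hterm : ∀ p, pd p (positionKulkarniNomizu S i k j p) x =
      ((if k = p then x p * S i j x else 0) + x k * (S i j x + x p * pd p (S i j) x))
      - ((if i = p then x p * S k j x else 0) + x i * (S k j x + x p * pd p (S k j) x))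
      - ((if k = p then x j * S i p x else 0)
        + x k * ((if j = p then S i p x else 0) + x j * pd p (S i p) x))
      + ((if i = p then x j * S k p x else 0)
        + x i * ((if j = p then S k p x else 0) + x j * pd p (S k p) x)) := by
    intro p
    unfold positionKulkarniNomizu
    rw [pd_add p (((h2 _ _ _ _).fun_sub (h2 _ _ _ _)).fun_sub (h2 _ _ _ _)) (h2 _ _ _ _),
      pd_sub p ((h2 _ _ _ _).fun_sub (h2 _ _ _ _)) (h2 _ _ _ _),
      pd_sub p (h2 _ _ _ _) (h2 _ _ _ _)]
    simp only [pd_coord_mul p _ (h1 _ _ _), pd_coord_mul p _ (hd _ _), if_true]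
  simp only [hterm, Finset.sum_add_distrib, Finset.sum_sub_distrib, ← Finset.mul_sum, hdiv,
    Finset.sum_ite_eq, Finset.mem_univ, if_true, Finset.sum_const, Finset.card_univ,
    Fintype.card_fin, nsmul_eq_mul]
  rw [hsym k i x]
  ring

theorem sum_pd_coord_mul_sub {U : Fin D → Fin D → (Fin D → ℝ) → ℝ}
    (hU : ∀ i j, Differentiable ℝ (U i j)) (hdiv : ∀ j x, ∑ k, pd k (U k j) x = 0)
    (i j : Fin D) (x : Fin D → ℝ) :
    ∑ k, pd k (fun y => y k * U i j y - y i * U k j y) x =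
      ∑ k, x k * pd k (U i j) x + (D - 1) * U i j x := by
  have h1 : ∀ a c d, DifferentiableAt ℝ (fun y : Fin D → ℝ => y a * U c d y) x := by
    intro a c d; have := hU c d; fun_prop
  simp only [fun k => pd_sub k (h1 k i j) (h1 i k j), pd_coord_mul _ _ (hU _ _ x), if_true,
    Finset.sum_sub_distrib, Finset.sum_add_distrib, ← Finset.mul_sum, hdiv, Finset.sum_ite_eq,
    Finset.mem_univ, Finset.sum_const, Finset.card_univ, Fintype.card_fin, nsmul_eq_mul]
  ring

end PartialDerivative

/-- Proposition 1: every smooth symmetric transverse tensor field T^{ij}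
on ℝ^D (D ≥ 2) is of the form T^{ij} = ∂_k∂_p R^{ikjp} for a smooth tensor field R
having Riemann symmetries. -/
theorem stmt_1 (D : ℕ) (hD : 2 ≤ D)
    (T : Fin D → Fin D → (Fin D → ℝ) → ℝ)
    (hsmooth : ∀ i j, ContDiff ℝ (⊤ : ℕ∞) (T i j))
    (hsym : ∀ i j x, T i j x = T j i x)
    (htrans : ∀ i x, ∑ j, pd j (T i j) x = 0) :
    ∃ R : Fin D → Fin D → Fin D → Fin D → (Fin D → ℝ) → ℝ,
      (∀ i k j p, ContDiff ℝ (⊤ : ℕ∞) (R i k j p)) ∧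
      (∀ i k j p x, R i k j p x = - R k i j p x) ∧
      (∀ i k j p x, R i k j p x = - R i k p j x) ∧
      (∀ i k j p x, R i k j p x = R j p i k x) ∧
      (∀ i k j p x,
        (1/6 : ℝ) * (R i k j p x - R i j k p x - R i k p j x
          - R i p j k x + R i j p k x + R i p k j x) = 0) ∧
      (∀ i j x, T i j x = ∑ k, ∑ p, pd k (pd p (R i k j p)) x) := by
  set U : Fin D → Fin D → (Fin D → ℝ) → ℝ := fun i j => radialIntegral (D - 2) (T i j) with hUdef
  set S : Fin D → Fin D → (Fin D → ℝ) → ℝ := fun i j => radialIntegral (D - 1) (U i j) with hSdef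
  have h1 : ∀ {f : (Fin D → ℝ) → ℝ}, ContDiff ℝ (⊤ : ℕ∞) f → ContDiff ℝ 1 f :=
    fun hf => hf.of_le (by exact_mod_cast le_top)
  have hUsmooth : ∀ i j, ContDiff ℝ (⊤ : ℕ∞) (U i j) := fun i j => (hsmooth i j).radialIntegral _
  have hSsmooth : ∀ i j, ContDiff ℝ (⊤ : ℕ∞) (S i j) := fun i j => (hUsmooth i j).radialIntegral _
  have hUsym : ∀ i j, U i j = U j i := fun i j => by
    simp only [hUdef, funext (hsym i j)]
  have hSsym : ∀ i j, S i j = S j i := fun i j => by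
    simp only [hSdef, hUsym i j]
  have hUdiv : ∀ i x, ∑ j, pd j (U i j) x = 0 := fun i =>
    sum_pd_radialIntegral_eq_zero _ (hsmooth i) (htrans i)
  have hSdiv : ∀ i x, ∑ j, pd j (S i j) x = 0 := fun i =>
    sum_pd_radialIntegral_eq_zero _ (hUsmooth i) (hUdiv i)
  have hSeuler : ∀ i j x, ∑ p, x p * pd p (S i j) x + D * S i j x = U i j x := by
    intro i j x
    have h := sum_mul_pd_radialIntegral (D - 1) (h1 (hUsmooth i j)) x
    rw [Nat.cast_sub (by lia)] at h
    simp only [hSdef, h]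
    push_cast
    ring
  have hUeuler : ∀ i j x, ∑ p, x p * pd p (U i j) x + (D - 1) * U i j x = T i j x := by
    intro i j x
    have h := sum_mul_pd_radialIntegral (D - 2) (h1 (hsmooth i j)) x
    rw [Nat.cast_sub hD] at h
    simp only [hUdef, h]
    push_cast
    ring
  have hRsmooth := contDiff_positionKulkarniNomizu hSsmooth
  refine ⟨positionKulkarniNomizu S, hRsmooth, ?_, ?_, ?_, ?_, ?_⟩
  · intro i k j p x
    simp only [positionKulkarniNomizu]
    ring
  · intro i k j p x
    simp only [positionKulkarniNomizu]
    ring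
  · intro i k j p x
    simp only [positionKulkarniNomizu]
    rw [hSsym j i, hSsym p i, hSsym j k, hSsym p k]
    ring
  · intro i k j p x
    simp only [positionKulkarniNomizu]
    rw [hSsym j k, hSsym p k, hSsym p j]
    ring
  · intro i j x
    have hdiffpd : ∀ k p, DifferentiableAt ℝ (pd p (positionKulkarniNomizu S i k j p)) x :=
      fun k p => (h1 (contDiff_pd p (hRsmooth i k j p))).differentiable one_ne_zero x
    simp_rw [fun k => (pd_sum k fun p (_ : p ∈ Finset.univ) => hdiffpd k p).symm,
      sum_pd_positionKulkarniNomizu (fun i j => (h1 (hSsmooth i j)).differentiable one_ne_zero)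
        (fun i j x => congrFun (hSsym i j) x) hSdiv, hSeuler]
    rw [sum_pd_coord_mul_sub (fun i j => (h1 (hUsmooth i j)).differentiable one_ne_zero)
      (fun j x => by simpa only [hUsym j] using hUdiv j x), hUeuler]
end

section
/- (Proposition 6) Let T^{ij} be a smooth symmetric tensor field on ℝ³ with ∂_j T^{ij}=0 for all i and δ_{ij}T^{ij}=0. Then there exists a smooth symmetric tensor field A_{ij} on ℝ³ such that T^{ij} = ε^{kl(i} ∂_l ( ΔA^{j)}_{k} − ∂_p∂^{j)} A_{kp} ), i.e. T^{ij} = (1/2) Σ_{k,l} [ ε^{kli} ∂_l ( ΔA_{jk} − Σ_p ∂_j∂_p A_{kp} ) + ε^{klj} ∂_l ( ΔA_{ik} − Σ_p ∂_i∂_p A_{kp} ) ]. -/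
/-- Euclidean Laplacian Σ_k ∂_k∂_k. -/
noncomputable def lap {D : ℕ} (f : (Fin D → ℝ) → ℝ) : (Fin D → ℝ) → ℝ :=
  fun x => ∑ k, pd k (pd k f) x

/-- Three-dimensional Levi-Civita symbol with ε^{123} = 1. -/
def eps3 (i j k : Fin 3) : ℝ :=
  if (i,j,k) = (0,1,2) ∨ (i,j,k) = (1,2,0) ∨ (i,j,k) = (2,0,1) then 1
  else if (i,j,k) = (2,1,0) ∨ (i,j,k) = (1,0,2) ∨ (i,j,k) = (0,2,1) then -1
  else 0

/-- Formula (26): T^{ij} = ε^{kl(i} ∂_l ( ΔA^{j)}_k − ∂_p∂^{j)} A_{kp} ). -/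
noncomputable def T26 (A : Fin 3 → Fin 3 → (Fin 3 → ℝ) → ℝ) (i j : Fin 3) :
    (Fin 3 → ℝ) → ℝ :=
  fun x => (1/2 : ℝ) * ∑ k, ∑ l,
    (eps3 k l i * pd l (fun y => lap (A j k) y - ∑ p, pd j (pd p (A k p)) y) x
     + eps3 k l j * pd l (fun y => lap (A i k) y - ∑ p, pd i (pd p (A k p)) y) x)

section ExactSequence

variable {M : Type*} [AddCommGroup M] [Module ℝ M]

/-- The curl of a triple of elements with respect to three abstract derivations. -/
def curl (d : Fin 3 → M →ₗ[ℝ] M) (W : Fin 3 → M) : Fin 3 → M :=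
  ![d 1 (W 2) - d 2 (W 1), d 2 (W 0) - d 0 (W 2), d 0 (W 1) - d 1 (W 0)]

/-- Formula (26) with respect to three abstract derivations. -/
noncomputable def symCurl (d : Fin 3 → M →ₗ[ℝ] M) (A : Fin 3 → Fin 3 → M) (i j : Fin 3) : M :=
  (1/2 : ℝ) • ∑ k, ∑ l,
    (eps3 k l i • d l (∑ p, d p (d p (A j k)) - ∑ p, d j (d p (A k p)))
     + eps3 k l j • d l (∑ p, d p (d p (A i k)) - ∑ p, d i (d p (A k p))))

/-- Divergence-free triples are curls as soon as `d 2` is surjective and `d 1` is surjective on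
the kernel of `d 2`. -/
theorem exists_curl_eq {d : Fin 3 → M →ₗ[ℝ] M} (hd : ∀ i j m, d i (d j m) = d j (d i m))
    (h₂ : ∀ f, ∃ g, d 2 g = f) (h₁ : ∀ f, d 2 f = 0 → ∃ g, d 1 g = f ∧ d 2 g = 0)
    (V : Fin 3 → M) (hV : ∑ k, d k (V k) = 0) : ∃ W, curl d W = V := by
  obtain ⟨a, ha⟩ := h₂ (V 1)
  obtain ⟨b, hb⟩ := h₂ (-V 0)
  obtain ⟨g, hg₁, hg₂⟩ := h₁ (V 2 - d 0 b + d 1 a) (by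
    rw [Fin.sum_univ_three] at hV
    rw [map_add, map_sub, hd 2 0, hd 2 1, ha, hb, map_neg, ← hV]
    abel)
  refine ⟨![a - g, b, 0], funext fun i => ?_⟩
  fin_cases i
  · simp [curl, hb]
  · simp [curl, ha, hg₂]
  · simp [curl, hg₁]

/-- If the matrix with rows `curl (B i)` is symmetric, then `B - tr B` is column-wise
divergence-free. -/
theorem sum_deriv_sub_trace_eq_zero {d : Fin 3 → M →ₗ[ℝ] M} {B : Fin 3 → Fin 3 → M}
    (hB : ∀ i j, curl d (B i) j = curl d (B j) i) (m : Fin 3) :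
    ∑ i, d i (B i m - if i = m then ∑ k, B k k else 0) = 0 := by
  have h₀ := hB 1 2
  have h₁ := hB 2 0
  have h₂ := hB 0 1
  simp only [curl, Matrix.cons_val] at h₀ h₁ h₂
  fin_cases m <;> simp [Fin.sum_univ_three]
  · linear_combination (norm := module) -h₀
  · linear_combination (norm := module) -h₁
  · linear_combination (norm := module) -h₂

theorem exists_symm_curl_eq {d : Fin 3 → M →ₗ[ℝ] M} (hd : ∀ i j m, d i (d j m) = d j (d i m))
    (hcurl : ∀ V : Fin 3 → M, ∑ k, d k (V k) = 0 → ∃ W, curl d W = V)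
    {T : Fin 3 → Fin 3 → M} (hdiv : ∀ i, ∑ j, d j (T i j) = 0) (htr : ∑ i, T i i = 0) :
    ∃ S : Fin 3 → Fin 3 → M, (∀ i j, S i j = S j i) ∧ ∀ i, curl d (S i) = T i := by
  choose S hS using fun i => hcurl (T i) (hdiv i)
  obtain ⟨f, hf⟩ := hcurl ![S 1 2 - S 2 1, S 2 0 - S 0 2, S 0 1 - S 1 0] (by
    simp only [← hS, curl, Fin.sum_univ_three, Matrix.cons_val, map_sub] at htr ⊢
    linear_combination (norm := module) -htr)
  have hf₀ := congrFun hf 0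
  have hf₁ := congrFun hf 1
  have hf₂ := congrFun hf 2
  simp only [curl, Matrix.cons_val] at hf₀ hf₁ hf₂
  refine ⟨fun i j => S i j + d j (f i), fun i j => ?_, fun i => ?_⟩
  · fin_cases i <;> fin_cases j <;> simp
    · linear_combination (norm := module) -hf₂
    · linear_combination (norm := module) hf₁
    · linear_combination (norm := module) hf₂
    · linear_combination (norm := module) -hf₀
    · linear_combination (norm := module) -hf₁
    · linear_combination (norm := module) hf₀
  · rw [← hS i]
    simp [curl, hd 1 0, hd 2 0, hd 2 1]

/-- Symmetric divergence-free tensors are in the range of the Saint-Venant operator. -/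
theorem exists_curl_curl_eq {d : Fin 3 → M →ₗ[ℝ] M} (hd : ∀ i j m, d i (d j m) = d j (d i m))
    (hcurl : ∀ V : Fin 3 → M, ∑ k, d k (V k) = 0 → ∃ W, curl d W = V)
    {G : Fin 3 → Fin 3 → M} (hsym : ∀ i j, G i j = G j i) (hdiv : ∀ i, ∑ j, d j (G i j) = 0) :
    ∃ D : Fin 3 → Fin 3 → M, (∀ i j, D i j = D j i) ∧
      ∀ i, curl d (fun l => curl d (D l) i) = G i := by
  choose B hB using fun i => hcurl (G i) (hdiv i)
  choose D hD using fun m => hcurl _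
    (sum_deriv_sub_trace_eq_zero (fun i j => by rw [hB, hB, hsym]) m : ∑ i, d i (B i m - _) = 0)
  refine ⟨fun i j => (1/2 : ℝ) • (D i j + D j i), fun i j => by simp only [add_comm], fun i => ?_⟩
  have hC := fun m i => congrFun (hD m) i
  rw [← hB i]
  have h : ∀ l, B i l = curl d (D l) i - if i = l then (1/2 : ℝ) • ∑ k, curl d (D k) k else 0 := by
    intro l
    simp only [hC, Fin.sum_univ_three]
    split_ifs <;> module
  rw [funext h]
  ext j
  fin_cases i <;> fin_cases j <;>
    simp [curl, Fin.sum_univ_three, hd 1 0, hd 2 0, hd 2 1] <;> module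

theorem exists_symCurl_eq {d : Fin 3 → M →ₗ[ℝ] M} (hd : ∀ i j m, d i (d j m) = d j (d i m))
    (hcurl : ∀ V : Fin 3 → M, ∑ k, d k (V k) = 0 → ∃ W, curl d W = V)
    {T : Fin 3 → Fin 3 → M} (hsym : ∀ i j, T i j = T j i) (hdiv : ∀ i, ∑ j, d j (T i j) = 0)
    (htr : ∑ i, T i i = 0) :
    ∃ A : Fin 3 → Fin 3 → M, (∀ i j, A i j = A j i) ∧ ∀ i j, T i j = symCurl d A i j := by
  obtain ⟨S, hS, hST⟩ := exists_symm_curl_eq hd hcurl hdiv htr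
  obtain ⟨A, hA, hAS⟩ := exists_curl_curl_eq hd hcurl
    (G := fun i j => S i j - if i = j then ∑ k, S k k else 0)
    (fun i j => by simp only [hS i j, eq_comm]) (fun i => by
      simpa only [hS i, eq_comm (a := i)] using
        sum_deriv_sub_trace_eq_zero (fun i j => by rw [hST, hST, hsym]) i)
  refine ⟨A, hA, fun i j => ?_⟩
  have h : ∀ i l, S i l = curl d (fun l => curl d (A l) i) l -
      if i = l then (1/2 : ℝ) • ∑ k, curl d (fun l => curl d (A l) k) k else 0 := by
    intro i l
    simp only [hAS, Fin.sum_univ_three]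
    split_ifs <;> module
  have hT : T i j = (1/2 : ℝ) • (curl d (S i) j + curl d (S j) i) := by
    rw [hST, hST, hsym j i]
    module
  rw [hT, funext (h i), funext (h j)]
  fin_cases i <;> fin_cases j <;>
    simp [curl, symCurl, eps3, Fin.sum_univ_three, hd 1 0, hd 2 0, hd 2 1, hA 1 0, hA 2 0, hA 2 1]
      <;> module

end ExactSequence

section Antiderivative

open intervalIntegral MeasureTheory Set

theorem contDiff_integral_of_contDiff_nat {H : Type} [NormedAddCommGroup H] [NormedSpace ℝ H]
    [ProperSpace H] (n : ℕ) : ∀ {E : Type} [NormedAddCommGroup E] [NormedSpace ℝ E]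
    [CompleteSpace E] {f : H × ℝ → E}, ContDiff ℝ n f →
      ContDiff ℝ n fun x => ∫ t in (0 : ℝ)..1, f (x, t) := by
  induction n with
  | zero =>
    intro E _ _ _ f hf
    rw [Nat.cast_zero, contDiff_zero] at hf ⊢
    exact continuous_parametric_intervalIntegral_of_continuous' (by exact hf) 0 1
  | succ n ih =>
    intro E _ _ _ f hf
    have hf' : ContDiff ℝ n fun p : H × ℝ => (fderiv ℝ f p).comp (.inl ℝ H ℝ) :=
      (hf.fderiv_right (by norm_cast)).clm_comp contDiff_const
    rw [Nat.cast_succ, contDiff_succ_iff_hasFDerivAt]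
    refine ⟨_, ih hf', fun x => ?_⟩
    obtain ⟨C, hC⟩ := ((isCompact_closedBall x 1).prod (isCompact_Icc (a := (0:ℝ)) (b := 1))
      ).exists_bound_of_continuousOn hf'.continuous.continuousOn
    have hm : ∀ x : H, Continuous fun t : ℝ => (x, t) := fun x => by fun_prop
    refine hasFDerivAt_integral_of_dominated_of_fderiv_le (bound := fun _ => C)
      (F := fun x t => f (x, t)) (μ := volume) (a := 0) (b := 1)
      (F' := fun x t => (fderiv ℝ f (x, t)).comp (.inl ℝ H ℝ))
      (Metric.closedBall_mem_nhds x one_pos)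
      (.of_forall fun y => (hf.continuous.comp (hm y)).aestronglyMeasurable)
      ((hf.continuous.comp (hm x)).intervalIntegrable _ _)
      ((hf'.continuous.comp (hm x)).aestronglyMeasurable) (.of_forall fun t ht y hy => ?_)
      intervalIntegrable_const (.of_forall fun t _ y _ => ?_)
    · rw [uIoc_of_le zero_le_one] at ht
      exact hC (y, t) ⟨hy, Ioc_subset_Icc_self ht⟩
    · exact ((hf.differentiable (by simp)) (y, t)).hasFDerivAt.comp y (hasFDerivAt_prodMk_left y t)

theorem contDiff_integral_of_contDiff {H E : Type} [NormedAddCommGroup H] [NormedSpace ℝ H]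
    [ProperSpace H] [NormedAddCommGroup E] [NormedSpace ℝ E] [CompleteSpace E] {f : H × ℝ → E}
    (hf : ContDiff ℝ (⊤ : ℕ∞) f) :
    ContDiff ℝ (⊤ : ℕ∞) fun x => ∫ t in (0 : ℝ)..1, f (x, t) :=
  contDiff_infty.2 fun n => contDiff_integral_of_contDiff_nat n (contDiff_infty.1 hf n)

variable {D : ℕ} {f : (Fin D → ℝ) → ℝ}

open Function

theorem hasDerivAt_comp_update (hf : Differentiable ℝ f) (k : Fin D) (x : Fin D → ℝ) (s : ℝ) :
    HasDerivAt (fun t => f (update x k t)) (pd k f (update x k s)) s :=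
  (hf _).hasFDerivAt.comp_hasDerivAt s (hasDerivAt_update x k s)

theorem pd_eq_of_hasDerivAt (hf : Differentiable ℝ f) {k : Fin D} {x : Fin D → ℝ} {c : ℝ}
    (h : HasDerivAt (fun t => f (update x k t)) c (x k)) : pd k f x = c := by
  simpa using (hasDerivAt_comp_update hf k x (x k)).unique h

theorem ContDiff.pd (hf : ContDiff ℝ (⊤ : ℕ∞) f) (k : Fin D) :
    ContDiff ℝ (⊤ : ℕ∞) (pd k f) :=
  (hf.fderiv_right (by norm_cast)).clm_apply contDiff_const

theorem pd_comm (hf : ContDiff ℝ (⊤ : ℕ∞) f) (j k : Fin D) : pd j (pd k f) = pd k (pd j f) := by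
  have h : Differentiable ℝ (fderiv ℝ f) :=
    (hf.fderiv_right (m := 1) (by norm_cast)).differentiable (by simp)
  have hp : ∀ i l x, pd i (pd l f) x
      = fderiv ℝ (fderiv ℝ f) x (Pi.single i 1) (Pi.single l 1) := fun i l x => by
    change fderiv ℝ (fun y => fderiv ℝ f y (Pi.single l 1)) x _ = _
    rw [fderiv_clm_apply (h x) (differentiableAt_const _)]
    simp
  ext x
  rw [hp, hp]
  exact (hf.contDiffAt.isSymmSndFDerivAt (by
    rw [minSmoothness_of_isRCLikeNormedField]
    exact WithTop.coe_le_coe.2 (le_top (a := (2 : ℕ∞))))) _ _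

theorem contDiff_update_prod (k : Fin D) :
    ContDiff ℝ (⊤ : ℕ∞) fun p : (Fin D → ℝ) × ℝ => update p.1 k p.2 := by
  rw [contDiff_pi]
  intro i
  rcases eq_or_ne i k with rfl | h
  · simpa using contDiff_snd
  · simp only [update_of_ne h]
    fun_prop

theorem exists_pd_eq (hf : ContDiff ℝ (⊤ : ℕ∞) f) (k : Fin D) :
    ∃ g, ContDiff ℝ (⊤ : ℕ∞) g ∧ pd k g = f := by
  have hg : ContDiff ℝ (⊤ : ℕ∞) fun x => ∫ t in (0 : ℝ)..x k, f (update x k t) := by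
    have h : ContDiff ℝ (⊤ : ℕ∞) fun p : (Fin D → ℝ) × ℝ => f (update p.1 k (p.1 k * p.2)) :=
      hf.comp ((contDiff_update_prod k).comp
        (by fun_prop : ContDiff ℝ _ fun p : (Fin D → ℝ) × ℝ => (p.1, p.1 k * p.2)))
    have h' : ContDiff ℝ (⊤ : ℕ∞) fun x : Fin D → ℝ => x k := by fun_prop
    have heq : (fun x : Fin D → ℝ => ∫ t in (0 : ℝ)..x k, f (update x k t)) =
        fun x => x k * ∫ t in (0 : ℝ)..1, f (update x k (x k * t)) := funext fun x => by
      simpa using (smul_integral_comp_mul_left (a := 0) (b := 1)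
        (fun t => f (update x k t)) (x k)).symm
    rw [heq]
    exact h'.mul (contDiff_integral_of_contDiff h)
  refine ⟨_, hg, funext fun x => pd_eq_of_hasDerivAt (hg.differentiable (by simp)) ?_⟩
  have hc : Continuous fun t => f (update x k t) := hf.continuous.comp (by fun_prop)
  simpa using integral_hasDerivAt_right (hc.intervalIntegrable 0 (x k))
    (hc.stronglyMeasurableAtFilter _ _) hc.continuousAt

theorem exists_pd_eq_of_pd_eq_zero (hf : ContDiff ℝ (⊤ : ℕ∞) f) {j k : Fin D} (hjk : j ≠ k)
    (h : pd k f = 0) : ∃ g, ContDiff ℝ (⊤ : ℕ∞) g ∧ pd j g = f ∧ pd k g = 0 := by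
  obtain ⟨g, hg, rfl⟩ := exists_pd_eq hf j
  have hp : ContDiff ℝ (⊤ : ℕ∞) fun x => g (update x k 0) :=
    hg.comp ((contDiff_update_prod k).comp
      (by fun_prop : ContDiff ℝ _ fun x : Fin D → ℝ => (x, (0 : ℝ))))
  have hp' := hp.differentiable (by simp)
  refine ⟨_, hp, funext fun x => pd_eq_of_hasDerivAt hp' ?_,
    funext fun x => pd_eq_of_hasDerivAt hp' ?_⟩
  · have hconst : pd j g (update x k 0) = pd j g x := by
      have hd := hasDerivAt_comp_update (hf.differentiable (by simp)) k x
      simpa using is_const_of_deriv_eq_zero (fun s => (hd s).differentiableAt)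
        (fun s => by rw [(hd s).deriv, h]; rfl) 0 (x k)
    have := hasDerivAt_comp_update (hg.differentiable (by simp)) j (update x k 0) (x j)
    rw [update_comm hjk.symm, update_eq_self, hconst] at this
    simpa only [update_comm hjk.symm] using this
  · simpa using hasDerivAt_const (x k) (g (update x k 0))

end Antiderivative

/-- The space of smooth functions on `ℝ^D`. -/
def smoothFunctions (D : ℕ) : Submodule ℝ ((Fin D → ℝ) → ℝ) where
  carrier := {f | ContDiff ℝ (⊤ : ℕ∞) f}
  add_mem' hf hg := ContDiff.add (𝕜 := ℝ) (n := (⊤ : ℕ∞)) (by exact hf) (by exact hg)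
  zero_mem' := contDiff_const (𝕜 := ℝ) (n := (⊤ : ℕ∞)) (c := (0 : ℝ))
  smul_mem' c _ hf := ContDiff.smul (𝕜 := ℝ) (n := (⊤ : ℕ∞)) (contDiff_const (c := c)) (by exact hf)

theorem mem_smoothFunctions {D : ℕ} {f : (Fin D → ℝ) → ℝ} :
    f ∈ smoothFunctions D ↔ ContDiff ℝ (⊤ : ℕ∞) f := Iff.rfl

theorem smoothFunctions.contDiff {D : ℕ} (f : smoothFunctions D) :
    ContDiff ℝ (⊤ : ℕ∞) (f : (Fin D → ℝ) → ℝ) := f.2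

/-- The partial derivative as an endomorphism of the space of smooth functions. -/
noncomputable def pdLinear {D : ℕ} (k : Fin D) : smoothFunctions D →ₗ[ℝ] smoothFunctions D where
  toFun f := ⟨pd k f, (smoothFunctions.contDiff f).pd k⟩
  map_add' f g := Subtype.ext <| funext fun x => by
    have hf := (smoothFunctions.contDiff f).differentiable (by simp) x
    have hg := (smoothFunctions.contDiff g).differentiable (by simp) x
    simp [pd, fderiv_add hf hg]
  map_smul' c f := Subtype.ext <| funext fun x => by
    have hf := (smoothFunctions.contDiff f).differentiable (by simp) x
    simp [pd, fderiv_const_smul hf c]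

theorem coe_pdLinear {D : ℕ} (k : Fin D) (f : smoothFunctions D) :
    (pdLinear k f : (Fin D → ℝ) → ℝ) = pd k f := rfl

theorem T26_coe (A : Fin 3 → Fin 3 → smoothFunctions 3) (i j : Fin 3) :
    T26 (fun i j => A i j) i j = symCurl pdLinear A i j := by
  have h : ∀ j k, (fun y => lap (A j k : (Fin 3 → ℝ) → ℝ) y
      - ∑ p, pd j (pd p (A k p : (Fin 3 → ℝ) → ℝ)) y)
      = ((∑ p, pdLinear p (pdLinear p (A j k)) - ∑ p, pdLinear j (pdLinear p (A k p)) :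
          smoothFunctions 3) : (Fin 3 → ℝ) → ℝ) := fun j k => by
    ext y
    simp [lap, coe_pdLinear]
  ext x
  simp only [T26, h]
  simp only [← coe_pdLinear]
  simp [symCurl]

/-- Proposition 6: every smooth symmetric transverse traceless tensor
field on ℝ³ is given by formula (26) for some smooth symmetric A_{ij}. -/
theorem stmt_15
    (T : Fin 3 → Fin 3 → (Fin 3 → ℝ) → ℝ)
    (hsmooth : ∀ i j, ContDiff ℝ (⊤ : ℕ∞) (T i j))
    (hsym : ∀ i j x, T i j x = T j i x)
    (htrans : ∀ i x, ∑ j, pd j (T i j) x = 0)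
    (htrace : ∀ x, ∑ i, T i i x = 0) :
    ∃ A : Fin 3 → Fin 3 → (Fin 3 → ℝ) → ℝ,
      (∀ i j, ContDiff ℝ (⊤ : ℕ∞) (A i j)) ∧
      (∀ i j x, A i j x = A j i x) ∧
      (∀ i j x, T i j x = T26 A i j x) := by
  have hd : ∀ (i j : Fin 3) (m : smoothFunctions 3),
      pdLinear i (pdLinear j m) = pdLinear j (pdLinear i m) :=
    fun i j m => Subtype.ext (pd_comm (smoothFunctions.contDiff m) i j)
  have hcurl := exists_curl_eq hd
    (fun f => let ⟨g, hg, h⟩ := exists_pd_eq (smoothFunctions.contDiff f) 2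
      ⟨⟨g, mem_smoothFunctions.2 hg⟩, Subtype.ext h⟩)
    (fun f hf =>
      let ⟨g, hg, h₁, h₂⟩ := exists_pd_eq_of_pd_eq_zero (smoothFunctions.contDiff f)
        (j := 1) (by decide) (congrArg Subtype.val hf)
      ⟨⟨g, mem_smoothFunctions.2 hg⟩, Subtype.ext h₁, Subtype.ext h₂⟩)
  obtain ⟨A, hA, hTA⟩ := exists_symCurl_eq hd hcurl (T := fun i j => ⟨T i j, mem_smoothFunctions.2 (hsmooth i j)⟩)
    (fun i j => Subtype.ext <| funext <| hsym i j)
    (fun i => Subtype.ext <| funext fun x => by simpa [coe_pdLinear] using htrans i x)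
    (Subtype.ext <| funext fun x => by simpa using htrace x)
  refine ⟨fun i j => A i j, fun i j => smoothFunctions.contDiff (A i j),
    fun i j x => by simp only [hA i j], fun i j x => ?_⟩
  rw [T26_coe, ← hTA]
end
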